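/- arXiv:1812.02990 — 5 statements merged into one kernel-verified Lean document; each statement's English description precedes it below -/
import Mathlib

section
/- Let ε > 0, q ∈ (0,1), and define g(s) = (s + ε)^q for s ≥ 0 and h(w) = ε·w + (1−q)·(w/q)^{−q/(1−q)} for w > 0. Then h is strictly convex on (0,∞), and for all s ≥ 0 one has h'(g'(s)) = −s, where g'(s) = q(s+ε)^{q−1}. -/
theorem hasDerivAt_lq_dual {ε q w : ℝ} (hq0 : 0 < q) (hq1 : q < 1) (hw : 0 < w) :
    HasDerivAt (fun w : ℝ => ε * w + (1 - q) * (w / q) ^ (-q / (1 - q)))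
      (ε - (w / q) ^ (-1 / (1 - q))) w := by
  have h1q : 1 - q ≠ 0 := by linarith
  have hexp : -q / (1 - q) - 1 = -1 / (1 - q) := by field_simp; ring
  refine HasDerivAt.congr_deriv (((hasDerivAt_id w).const_mul ε).add
    ((((hasDerivAt_id w).div_const q).rpow_const (p := -q / (1 - q))
      (Or.inl (div_pos hw hq0).ne')).const_mul (1 - q))) ?_
  rw [hexp]
  simp only [id]
  field_simp
  ring

/-- Example (b): for `g(s) = (s+ε)^q`, `q ∈ (0,1)`, and
`h(w) = εw + (1−q)(w/q)^{−q/(1−q)}`, `h` is strictly convex on `(0,∞)` and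
`h'(g'(s)) = −s` with `g'(s) = q(s+ε)^{q−1}`, for all `s ≥ 0`. -/
theorem lq_penalty_pair (ε q : ℝ) (hε : 0 < ε) (hq0 : 0 < q) (hq1 : q < 1) :
    StrictConvexOn ℝ (Set.Ioi (0 : ℝ))
      (fun w : ℝ => ε * w + (1 - q) * (w / q) ^ (-q / (1 - q))) ∧
    ∀ s : ℝ, 0 ≤ s →
      deriv (fun u : ℝ => (u + ε) ^ q) s = q * (s + ε) ^ (q - 1) ∧
      deriv (fun w : ℝ => ε * w + (1 - q) * (w / q) ^ (-q / (1 - q)))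
        (q * (s + ε) ^ (q - 1)) = -s := by
  refine ⟨?_, fun s hs => ?_⟩
  · have hderiv {w : ℝ} (hw : w ∈ Set.Ioi (0 : ℝ)) :=
      hasDerivAt_lq_dual (ε := ε) hq0 hq1 (Set.mem_Ioi.mp hw)
    refine StrictMonoOn.strictConvexOn_of_deriv (convex_Ioi 0)
      (fun w hw => (hderiv hw).continuousAt.continuousWithinAt) ?_
    rw [interior_Ioi]
    intro x hx y hy hxy
    rw [(hderiv hx).deriv, (hderiv hy).deriv]
    exact sub_lt_sub_left (Real.rpow_lt_rpow_of_neg (div_pos hx hq0)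
      (div_lt_div_of_pos_right hxy hq0)
      (div_neg_of_neg_of_pos neg_one_lt_zero (sub_pos.mpr hq1))) ε
  · have hsε : 0 < s + ε := by linarith
    have h1q : 1 - q ≠ 0 := by linarith
    constructor
    · simpa using (((hasDerivAt_id s).add_const ε).rpow_const (p := q) (Or.inl hsε.ne')).deriv
    · have hexp : (q - 1) * (-1 / (1 - q)) = 1 := by field_simp; ring
      rw [(hasDerivAt_lq_dual hq0 hq1 (mul_pos hq0 (Real.rpow_pos_of_pos hsε _))).deriv,
        mul_div_cancel_left₀ _ hq0.ne', ← Real.rpow_mul hsε.le, hexp, Real.rpow_one]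
      ring
end

section
/- Let A be a real m×n matrix, y ∈ ℝ^m, ε > 0, λ > 0, and define F : ℝ^n × (0,∞)^n → ℝ by F(x,w) = (1/2)‖y − Ax‖₂² + λ Σ_{i=1}^n (w_i|x_i| + ε·w_i − log(w_i)). Then for every c ∈ ℝ the sublevel set {(x,w) ∈ ℝ^n × (0,∞)^n : F(x,w) ≤ c} is a compact subset of ℝ^n × ℝ^n. -/
theorem EuclideanSpace.isCompact_setOf_forall_mem_Icc {ι : Type*} [Fintype ι] (a b : ℝ) :
    IsCompact {x : EuclideanSpace ℝ ι | ∀ i, x i ∈ Set.Icc a b} := by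
  have h : {x : EuclideanSpace ℝ ι | ∀ i, x i ∈ Set.Icc a b} =
      WithLp.toLp 2 '' Set.Icc (fun _ : ι => a) (fun _ => b) := by
    ext x
    constructor
    · intro hx
      exact ⟨WithLp.ofLp x, ⟨fun i => (hx i).1, fun i => (hx i).2⟩, rfl⟩
    · rintro ⟨z, hz, rfl⟩ i
      exact ⟨hz.1 i, hz.2 i⟩
  rw [h]
  exact isCompact_Icc.image (PiLp.continuous_toLp 2 _)

theorem Real.log_add_one_le_mul_sub_log {w b : ℝ} (hw : 0 < w) (hb : 0 < b) :
    Real.log b + 1 ≤ w * b - Real.log w := by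
  have h := Real.log_le_sub_one_of_pos (mul_pos hw hb)
  rw [Real.log_mul hw.ne' hb.ne'] at h
  linarith

/-- For the log penalty, every sublevel set of the biconvex functional
`F(x,w) = (1/2)‖y − Ax‖₂² + λ ∑ᵢ (wᵢ|xᵢ| + εwᵢ − log wᵢ)` on `ℝⁿ × (0,∞)ⁿ`
is compact in `ℝⁿ × ℝⁿ`. -/
theorem log_penalty_sublevel_compact (m n : ℕ)
    (A : EuclideanSpace ℝ (Fin n) →L[ℝ] EuclideanSpace ℝ (Fin m))
    (y : EuclideanSpace ℝ (Fin m)) (ε lam : ℝ) (hε : 0 < ε) (hlam : 0 < lam) (c : ℝ) :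
    IsCompact {p : EuclideanSpace ℝ (Fin n) × EuclideanSpace ℝ (Fin n) |
      (∀ i, 0 < p.2 i) ∧
      (1 / 2) * ‖y - A p.1‖ ^ 2 +
        lam * ∑ i, (p.2 i * |p.1 i| + ε * p.2 i - Real.log (p.2 i)) ≤ c} := by
  set L : ℝ := Real.log ε + 1 with hL
  set K : ℝ := c / lam - n * L + L with hK
  set R : ℝ := Real.exp (K - 1) with hR
  set M : ℝ := 2 * (K - 1 - Real.log (ε / 2)) / ε with hM
  let T := {x : EuclideanSpace ℝ (Fin n) | ∀ i, x i ∈ Set.Icc (-R) R} ×ˢ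
    {w : EuclideanSpace ℝ (Fin n) | ∀ i, w i ∈ Set.Icc (Real.exp (-K)) M}
  let F : EuclideanSpace ℝ (Fin n) × EuclideanSpace ℝ (Fin n) → ℝ := fun p =>
    (1 / 2) * ‖y - A p.1‖ ^ 2 +
      lam * ∑ i, (p.2 i * |p.1 i| + ε * p.2 i - Real.log (p.2 i))
  have hT : IsCompact T :=
    (EuclideanSpace.isCompact_setOf_forall_mem_Icc _ _).prod
      (EuclideanSpace.isCompact_setOf_forall_mem_Icc _ _)
  have hpos : ∀ p ∈ T, ∀ i, 0 < p.2 i := fun p hp i =>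
    (Real.exp_pos _).trans_le (hp.2 i).1
  have hF : ContinuousOn F T := by
    refine ContinuousOn.add (by fun_prop) (continuousOn_const.mul ?_)
    refine continuousOn_finsetSum _ fun i _ => ContinuousOn.sub (by fun_prop) ?_
    exact ContinuousOn.log (by fun_prop) fun p hp => (hpos p hp i).ne'
  have hcompact : IsCompact (T ∩ F ⁻¹' Set.Iic c) :=
    hT.of_isClosed_subset (hF.preimage_isClosed_of_isClosed hT.isClosed isClosed_Iic)
      Set.inter_subset_left
  convert hcompact using 1
  ext p
  refine ⟨fun ⟨hw, hp⟩ => ⟨?_, hp⟩, fun hp => ⟨hpos p hp.1, hp.2⟩⟩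
  have hterm : ∀ i, L ≤ p.2 i * |p.1 i| + ε * p.2 i - Real.log (p.2 i) := fun i => by
    have h₁ := Real.log_add_one_le_mul_sub_log (hw i) hε
    have h₂ := mul_nonneg (hw i).le (abs_nonneg (p.1 i))
    linarith
  have hsum : ∑ i, (p.2 i * |p.1 i| + ε * p.2 i - Real.log (p.2 i)) ≤ c / lam := by
    rw [le_div_iff₀' hlam]
    linarith [sq_nonneg ‖y - A p.1‖]
  have hle : ∀ i, p.2 i * |p.1 i| + ε * p.2 i - Real.log (p.2 i) ≤ K := fun i => by
    have h := Finset.single_le_sum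
      (f := fun j => p.2 j * |p.1 j| + ε * p.2 j - Real.log (p.2 j) - L)
      (fun j _ => sub_nonneg.2 (hterm j)) (Finset.mem_univ i)
    simp only [Finset.sum_sub_distrib _ (fun _ => L), Finset.sum_const, Finset.card_univ,
      Fintype.card_fin, nsmul_eq_mul] at h
    linarith
  have hwx : ∀ i, 0 ≤ p.2 i * |p.1 i| := fun i => mul_nonneg (hw i).le (abs_nonneg _)
  refine ⟨fun i => abs_le.1 ?_, fun i => ⟨?_, ?_⟩⟩
  · have hb : 0 < |p.1 i| + ε := by positivity
    have h := Real.log_add_one_le_mul_sub_log (hw i) hb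
    have hexp : |p.1 i| + ε ≤ R := (Real.log_le_iff_le_exp hb).1 (by linarith [hle i])
    linarith
  · refine (Real.le_log_iff_exp_le (hw i)).1 ?_
    linarith [hle i, hwx i, mul_pos hε (hw i)]
  · rw [hM, le_div_iff₀ hε]
    linarith [hle i, hwx i, Real.log_add_one_le_mul_sub_log (hw i) (half_pos hε)]
end

section
/- Let E and F be finite-dimensional real normed vector spaces, X ⊆ E and Y ⊆ F closed sets, and f : X × Y → ℝ continuous. Let (x_t, w_t)_{t≥0} be a sequence in X × Y such that for every t, x_{t+1} is the unique minimizer over X of x ↦ f(x, w_t) and w_{t+1} is the unique minimizer over Y of w ↦ f(x_{t+1}, w). If the sequence (x_t, w_t) is contained in a compact subset of X × Y, then every accumulation point (x*, w*) of the sequence is a partial optimum of f, i.e., f(x*, w*) ≤ f(x, w*) for all x ∈ X and f(x*, w*) ≤ f(x*, w) for all w ∈ Y. -/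
/-- Partial-optimality half of Gorski–Pfeuffer–Klamroth Theorem 4.9: every accumulation
point of an alternated convex search sequence (with unique minimizers at every step)
contained in a compact set is a partial optimum of `f`. -/
theorem acs_accumulation_points_partial_optima
    {E F : Type*} [NormedAddCommGroup E] [NormedSpace ℝ E] [FiniteDimensional ℝ E]
    [NormedAddCommGroup F] [NormedSpace ℝ F] [FiniteDimensional ℝ F]
    (X : Set E) (Y : Set F) (hX : IsClosed X) (hY : IsClosed Y)
    (f : E × F → ℝ) (hf : ContinuousOn f (X ×ˢ Y))
    (x : ℕ → E) (w : ℕ → F) (hxX : ∀ t, x t ∈ X) (hwY : ∀ t, w t ∈ Y)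
    (hxmin : ∀ t, ∀ x' ∈ X, x' ≠ x (t + 1) → f (x (t + 1), w t) < f (x', w t))
    (hwmin : ∀ t, ∀ w' ∈ Y, w' ≠ w (t + 1) → f (x (t + 1), w (t + 1)) < f (x (t + 1), w'))
    (K : Set (E × F)) (hK : IsCompact K) (hKsub : K ⊆ X ×ˢ Y)
    (hseq : ∀ t, (x t, w t) ∈ K)
    (xstar : E) (wstar : F)
    (hacc : MapClusterPt (xstar, wstar) Filter.atTop (fun t => (x t, w t))) :
    (∀ x' ∈ X, f (xstar, wstar) ≤ f (x', wstar)) ∧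
    (∀ w' ∈ Y, f (xstar, wstar) ≤ f (xstar, w')) := by
  obtain ⟨U, hU, hlim⟩ := mapClusterPt_iff_ultrafilter.1 hacc
  have hlim_x : Filter.Tendsto x U (nhds xstar) := (continuous_fst.tendsto _).comp hlim
  have hlim_w : Filter.Tendsto w U (nhds wstar) := (continuous_snd.tendsto _).comp hlim
  have hxs : xstar ∈ X := hX.mem_of_tendsto hlim_x (Filter.Eventually.of_forall hxX)
  have hws : wstar ∈ Y := hY.mem_of_tendsto hlim_w (Filter.Eventually.of_forall hwY)
  have hxle : ∀ t, ∀ x' ∈ X, f (x (t + 1), w t) ≤ f (x', w t) := by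
    intro t x' hx'
    by_cases h : x' = x (t + 1)
    · rw [h]
    · exact (hxmin t x' hx' h).le
  have hwle : ∀ t, ∀ w' ∈ Y, f (x (t + 1), w (t + 1)) ≤ f (x (t + 1), w') := by
    intro t w' hw'
    by_cases h : w' = w (t + 1)
    · rw [h]
    · exact (hwmin t w' hw' h).le
  have hanti : Antitone fun t => f (x t, w t) :=
    antitone_nat_of_succ_le fun t => (hwle t _ (hwY t)).trans (hxle t _ (hxX t))
  have hcont : ∀ (a : ℕ → E) (b : ℕ → F) (a₀ : E) (b₀ : F), (∀ t, a t ∈ X) → (∀ t, b t ∈ Y) →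
      a₀ ∈ X → b₀ ∈ Y → Filter.Tendsto a U (nhds a₀) → Filter.Tendsto b U (nhds b₀) →
      Filter.Tendsto (fun t => f (a t, b t)) U (nhds (f (a₀, b₀))) := by
    intro a b a₀ b₀ ha hb ha₀ hb₀ hta htb
    exact (hf (a₀, b₀) ⟨ha₀, hb₀⟩).tendsto.comp
      (tendsto_nhdsWithin_iff.2
        ⟨hta.prodMk_nhds htb, Filter.Eventually.of_forall fun t => ⟨ha t, hb t⟩⟩)
  have hval := hcont x w xstar wstar hxX hwY hxs hws hlim_x hlim_w
  have hlower : ∀ s, f (xstar, wstar) ≤ f (x s, w s) := fun s =>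
    le_of_tendsto hval (hU ((Filter.eventually_ge_atTop s).mono fun _ ht => hanti ht))
  refine ⟨fun x' hx' => ?_, fun w' hw' => ?_⟩
  · exact ge_of_tendsto (hcont (fun _ => x') w x' wstar (fun _ => hx') hwY hx' hws
      tendsto_const_nhds hlim_w) (Filter.Eventually.of_forall fun t =>
        (hlower (t + 1)).trans ((hwle t _ (hwY t)).trans (hxle t x' hx')))
  · refine le_of_tendsto_of_tendsto hval (hcont x (fun _ => w') xstar w' hxX (fun _ => hw') hxs hw'
      hlim_x tendsto_const_nhds) (hU ((Filter.eventually_ge_atTop 1).mono fun t ht => ?_))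
    obtain ⟨s, rfl⟩ := Nat.exists_eq_add_of_le' ht
    exact hwle s w' hw'
end

section
/- Let A be a real m×n matrix, y ∈ ℝ^m, λ > 0, β > 0. Let g : [0,β] → ℝ be strictly concave, increasing, and differentiable (one-sided derivatives at the endpoints), and let h : [g'(β), g'(0)] → ℝ be differentiable with h'(g'(s)) = −s for all s ∈ [0,β]. Set X = [−β,β]^n, Y = [g'(β), g'(0)]^n, and F(x,w) = (1/2)‖y − Ax‖₂² + λ Σ_{i=1}^n (w_i|x_i| + h(w_i)). Let (x(t), w(t)) be a sequence in X × Y such that for every t: w_i(t) = g'(|x_i(t)|) for all i, and x(t+1) is the unique minimizer over X of x ↦ (1/2)‖y − Ax‖₂² + λ Σ_{i=1}^n w_i(t)|x_i|. Assume the minimizer of the weighted Lasso step is unique at every t. Then ‖(x(t+1), w(t+1)) − (x(t), w(t))‖ → 0 as t → ∞, and every accumulation point of (x(t), w(t)) is a partial optimum of F, i.e., it minimizes F separately in each of the two blocks over X and over Y respectively. -/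
open Set Filter Topology

/-- A strictly monotone function with order-connected image is continuous. -/
theorem StrictMonoOn.continuousOn_of_ordConnected_image {f : ℝ → ℝ} {s : Set ℝ}
    (hf : StrictMonoOn f s) (hs : s.OrdConnected) (hfs : (f '' s).OrdConnected) :
    ContinuousOn f s := by
  rw [continuousOn_iff_continuous_domRestrict]
  exact continuous_subtype_val.comp (hf.orderIso f s).continuous

/-- The derivative of a strictly concave function on a compact interval is strictly decreasing. -/
theorem StrictConcaveOn.strictAntiOn_of_hasDerivWithinAt {g g' : ℝ → ℝ} {a b : ℝ} (hab : a < b)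
    (hg : StrictConcaveOn ℝ (Icc a b) g)
    (hg' : ∀ s ∈ Icc a b, HasDerivWithinAt g (g' s) (Icc a b) s) :
    StrictAntiOn g' (Icc a b) :=
  (hg.strictAntiOn_derivWithin fun s hs => (hg' s hs).differentiableWithinAt).congr
    fun s hs => (hg' s hs).derivWithin (uniqueDiffOn_Icc hab s hs)

/-- The derivative of a strictly concave function on a compact interval is continuous. -/
theorem StrictConcaveOn.continuousOn_of_hasDerivWithinAt {g g' : ℝ → ℝ} {a b : ℝ} (hab : a < b)
    (hg : StrictConcaveOn ℝ (Icc a b) g)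
    (hg' : ∀ s ∈ Icc a b, HasDerivWithinAt g (g' s) (Icc a b) s) :
    ContinuousOn g' (Icc a b) := by
  have hmono : StrictMonoOn (fun s => -g' s) (Icc a b) :=
    (hg.strictAntiOn_of_hasDerivWithinAt hab hg').neg
  have hcont := hmono.continuousOn_of_ordConnected_image ordConnected_Icc
    (ordConnected_Icc.image_hasDerivWithinAt fun s hs => (hg' s hs).neg)
  exact hcont.neg.congr fun s _ => (neg_neg (g' s)).symm

/-- If `-h'` is a left inverse of the strictly decreasing derivative `g'`, then `g' s` is the unique minimizer
of `u ↦ u * s + h u`. -/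
theorem mul_add_lt_of_deriv_eq_neg_inverse {g g' h h' : ℝ → ℝ} {β s u : ℝ}
    (hanti : StrictAntiOn g' (Icc 0 β))
    (hg' : ∀ s ∈ Icc 0 β, HasDerivWithinAt g (g' s) (Icc 0 β) s)
    (hh : ∀ u ∈ Icc (g' β) (g' 0), HasDerivWithinAt h (h' u) (Icc (g' β) (g' 0)) u)
    (hinv : ∀ s ∈ Icc 0 β, h' (g' s) = -s)
    (hs : s ∈ Icc 0 β) (hu : u ∈ Icc (g' β) (g' 0)) (hne : u ≠ g' s) :
    g' s * s + h (g' s) < u * s + h u := by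
  have hβ : 0 ≤ β := hs.1.trans hs.2
  have hmem : g' s ∈ Icc (g' β) (g' 0) :=
    ⟨hanti.antitoneOn hs (right_mem_Icc.2 hβ) hs.2, hanti.antitoneOn (left_mem_Icc.2 hβ) hs hs.1⟩
  have hsurj : ∀ v ∈ Icc (g' β) (g' 0), ∃ r ∈ Icc 0 β, g' r = v := fun v hv =>
    (ordConnected_Icc.image_hasDerivWithinAt hg').out (mem_image_of_mem _ (right_mem_Icc.2 hβ))
      (mem_image_of_mem _ (left_mem_Icc.2 hβ)) hv
  have hmvt : ∀ v ∈ Icc (g' β) (g' 0), ∀ v' ∈ Icc (g' β) (g' 0), v < v' →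
      ∃ r ∈ Icc 0 β, g' r ∈ Ioo v v' ∧ h v' - h v = -r * (v' - v) := by
    intro v hv v' hv' hlt
    have hsub : Icc v v' ⊆ Icc (g' β) (g' 0) := Icc_subset_Icc hv.1 hv'.2
    obtain ⟨c, hc, hc'⟩ := exists_hasDerivAt_eq_slope h h' hlt
      (fun z hz => ((hh z (hsub hz)).mono hsub).continuousWithinAt)
      (fun z hz => ((hh z (hsub (Ioo_subset_Icc_self hz))).mono hsub).hasDerivAt
        (Icc_mem_nhds hz.1 hz.2))
    obtain ⟨r, hr, rfl⟩ := hsurj c (hsub (Ioo_subset_Icc_self hc))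
    refine ⟨r, hr, hc, ?_⟩
    rw [hinv r hr] at hc'
    rw [hc', div_mul_cancel₀ _ (sub_pos.2 hlt).ne']
  rcases hne.lt_or_gt with hlt | hlt
  · obtain ⟨r, hr, hru, heq⟩ := hmvt u hu _ hmem hlt
    have hsr : s < r := (hanti.lt_iff_gt hr hs).1 hru.2
    nlinarith [mul_pos (sub_pos.2 hsr) (sub_pos.2 hlt)]
  · obtain ⟨r, hr, hru, heq⟩ := hmvt _ hmem u hu hlt
    have hrs : r < s := (hanti.lt_iff_gt hs hr).1 hru.1
    nlinarith [mul_pos (sub_pos.2 hrs) (sub_pos.2 hlt)]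

/-- The weighted Lasso objective. -/
noncomputable def weightedLasso {m n : ℕ}
    (A : EuclideanSpace ℝ (Fin n) →L[ℝ] EuclideanSpace ℝ (Fin m))
    (y : EuclideanSpace ℝ (Fin m)) (lam : ℝ) (w x : EuclideanSpace ℝ (Fin n)) : ℝ :=
  (1 / 2) * ‖y - A x‖ ^ 2 + lam * ∑ i, w i * |x i|

section WeightedLasso

variable {m n : ℕ} {A : EuclideanSpace ℝ (Fin n) →L[ℝ] EuclideanSpace ℝ (Fin m)}
  {y : EuclideanSpace ℝ (Fin m)} {lam β : ℝ} {X : Set (EuclideanSpace ℝ (Fin n))}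

theorem continuous_weightedLasso : Continuous fun p : EuclideanSpace ℝ (Fin n) ×
    EuclideanSpace ℝ (Fin n) => weightedLasso A y lam p.1 p.2 := by
  unfold weightedLasso
  fun_prop

theorem weightedLasso_le_of_abs_le (hlam : 0 ≤ lam) {w x x' : EuclideanSpace ℝ (Fin n)}
    (hw : ∀ i, 0 ≤ w i) (hA : ‖y - A x‖ ≤ ‖y - A x'‖) (hx : ∀ i, |x i| ≤ |x' i|) :
    weightedLasso A y lam w x ≤ weightedLasso A y lam w x' := by
  unfold weightedLasso
  gcongr ?_ + lam * ?_
  · gcongr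
  · exact Finset.sum_le_sum fun i _ => mul_le_mul_of_nonneg_left (hx i) (hw i)

/-- Two minimizers of the weighted Lasso over a box whose coordinates agree in absolute value
have the same image. -/
theorem map_eq_of_weightedLasso_minimizers
    (hX : X = {x : EuclideanSpace ℝ (Fin n) | ∀ i, x i ∈ Icc (-β) β}) (hlam : 0 ≤ lam)
    {w a b : EuclideanSpace ℝ (Fin n)} (hw : ∀ i, 0 ≤ w i) (hb : b ∈ X)
    (habs : ∀ i, |a i| = |b i|)
    (heq : weightedLasso A y lam w a = weightedLasso A y lam w b)
    (hmin : ∀ x' ∈ X, weightedLasso A y lam w b ≤ weightedLasso A y lam w x') :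
    A a = A b := by
  subst hX
  set c : EuclideanSpace ℝ (Fin n) := (1 / 2 : ℝ) • (a + b) with hc
  have hcb : ∀ i, |c i| ≤ |b i| := fun i => by
    have hci : c i = (1 / 2) * (a i + b i) := by simp [hc, mul_add]
    have habi := abs_add_le (a i) (b i)
    rw [hci, abs_mul, abs_of_pos one_half_pos]
    linarith [habs i]
  have hcX : ∀ i, c i ∈ Icc (-β) β := fun i =>
    abs_le.1 ((hcb i).trans (abs_le.2 (hb i)))
  have hsum : ∑ i, w i * |c i| ≤ ∑ i, w i * |b i| :=
    Finset.sum_le_sum fun i _ => mul_le_mul_of_nonneg_left (hcb i) (hw i)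
  have hbc := hmin c hcX
  simp only [weightedLasso, habs] at hbc heq
  have hlsum := mul_le_mul_of_nonneg_left hsum hlam
  have hAc : y - A c = (1 / 2 : ℝ) • ((y - A a) + (y - A b)) := by
    rw [hc, map_smul, map_add]
    module
  have hpar := parallelogram_law_with_norm ℝ (y - A a) (y - A b)
  have hnorm : ‖y - A c‖ ^ 2 = (1 / 4) * ‖(y - A a) + (y - A b)‖ ^ 2 := by
    rw [hAc, norm_smul, mul_pow]
    norm_num
  have hzero : ‖(y - A a) - (y - A b)‖ ^ 2 ≤ 0 := by nlinarith
  have hsub : (y - A a) - (y - A b) = 0 := by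
    rw [← norm_eq_zero]
    exact pow_eq_zero_iff two_ne_zero |>.1 (le_antisymm hzero (sq_nonneg _))
  exact (sub_right_injective (sub_eq_zero.1 hsub))

/-- A limit of unique weighted Lasso minimizers over a box cannot differ only by sign changes
from a point with the same image. -/
theorem eq_of_tendsto_weightedLasso_minimizers {ι : Type*} {l : Filter ι} [l.NeBot]
    (hX : X = {x : EuclideanSpace ℝ (Fin n) | ∀ i, x i ∈ Icc (-β) β}) (hlam : 0 ≤ lam)
    {w z : ι → EuclideanSpace ℝ (Fin n)} {a b : EuclideanSpace ℝ (Fin n)}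
    (hw : ∀ t i, 0 ≤ w t i) (hzX : ∀ t, z t ∈ X) (hz : Tendsto z l (𝓝 b))
    (hmin : ∀ t, ∀ x' ∈ X, x' ≠ z t →
      weightedLasso A y lam (w t) (z t) < weightedLasso A y lam (w t) x')
    (habs : ∀ i, |a i| = |b i|) (hA : A a = A b) : a = b := by
  by_contra hab
  subst hX
  have hcoord : ∀ i, Tendsto (fun t => z t i) l (𝓝 (b i)) := fun i =>
    ((EuclideanSpace.proj i : EuclideanSpace ℝ (Fin n) →L[ℝ] ℝ).continuous.tendsto b).comp hz
  have hev : ∀ᶠ t in l, ∀ i, |(z t + (1 / 2 : ℝ) • (a - b)) i| ≤ |z t i| := by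
    refine eventually_all.2 fun i => ?_
    have happ : ∀ t, (z t + (1 / 2 : ℝ) • (a - b)) i = z t i + (1 / 2) * (a i - b i) :=
      fun t => by simp
    simp only [happ]
    rcases abs_eq_abs.1 (habs i) with hi | hi
    · exact Eventually.of_forall fun t => by simp [hi]
    · by_cases hbi : b i = 0
      · exact Eventually.of_forall fun t => by simp [hi, hbi]
      · have hlt : |b i + (1 / 2) * (a i - b i)| < |b i| := by
          rw [hi]
          ring_nf
          simpa using hbi
        exact (((hcoord i).add_const _).abs.eventually_lt (hcoord i).abs hlt).mono
          fun t ht => ht.le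
  obtain ⟨t, ht⟩ := hev.exists
  refine (hmin t (z t + (1 / 2 : ℝ) • (a - b))
    (fun i => abs_le.1 ((ht i).trans (abs_le.2 (hzX t i)))) ?_).not_ge ?_
  · simpa [sub_eq_zero] using hab
  · refine weightedLasso_le_of_abs_le hlam (hw t) (le_of_eq ?_) ht
    simp [hA]

end WeightedLasso


/-- Theorem 2 of the paper: the iterates of the Lasso IRL1 algorithm (an alternated
convex search for the biconvex functional `F`) numerically converge, and every
accumulation point is a partial optimum of `F`. -/
theorem lasso_irl1_numerical_convergence (m n : ℕ)
    (A : EuclideanSpace ℝ (Fin n) →L[ℝ] EuclideanSpace ℝ (Fin m))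
    (y : EuclideanSpace ℝ (Fin m)) (lam β : ℝ) (hlam : 0 < lam) (hβ : 0 < β)
    (g g' h h' : ℝ → ℝ)
    (hg_concave : StrictConcaveOn ℝ (Set.Icc 0 β) g)
    (hg_mono : StrictMonoOn g (Set.Icc 0 β))
    (hg_deriv : ∀ s ∈ Set.Icc 0 β, HasDerivWithinAt g (g' s) (Set.Icc 0 β) s)
    (hh_deriv : ∀ u ∈ Set.Icc (g' β) (g' 0),
      HasDerivWithinAt h (h' u) (Set.Icc (g' β) (g' 0)) u)
    (hinv : ∀ s ∈ Set.Icc 0 β, h' (g' s) = -s)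
    (X Y : Set (EuclideanSpace ℝ (Fin n)))
    (hX : X = {x : EuclideanSpace ℝ (Fin n) | ∀ i, x i ∈ Set.Icc (-β) β})
    (hY : Y = {w : EuclideanSpace ℝ (Fin n) | ∀ i, w i ∈ Set.Icc (g' β) (g' 0)})
    (F : EuclideanSpace ℝ (Fin n) × EuclideanSpace ℝ (Fin n) → ℝ)
    (hF : ∀ p, F p =
      (1 / 2) * ‖y - A p.1‖ ^ 2 + lam * ∑ i, (p.2 i * |p.1 i| + h (p.2 i)))
    (x w : ℕ → EuclideanSpace ℝ (Fin n))
    (hxX : ∀ t, x t ∈ X)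
    (hwupd : ∀ t, ∀ i, w t i = g' |x t i|)
    (hxmin : ∀ t, ∀ x' ∈ X, x' ≠ x (t + 1) →
      (1 / 2) * ‖y - A (x (t + 1))‖ ^ 2 + lam * ∑ i, w t i * |x (t + 1) i| <
      (1 / 2) * ‖y - A x'‖ ^ 2 + lam * ∑ i, w t i * |x' i|) :
    Filter.Tendsto
      (fun t => ‖((x (t + 1), w (t + 1)) :
        EuclideanSpace ℝ (Fin n) × EuclideanSpace ℝ (Fin n)) - (x t, w t)‖)
      Filter.atTop (nhds 0) ∧
    ∀ p : EuclideanSpace ℝ (Fin n) × EuclideanSpace ℝ (Fin n),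
      MapClusterPt p Filter.atTop (fun t => (x t, w t)) →
      (∀ x' ∈ X, F p ≤ F (x', p.2)) ∧ (∀ w' ∈ Y, F p ≤ F (p.1, w')) := by
  have hanti := hg_concave.strictAntiOn_of_hasDerivWithinAt hβ hg_deriv
  have hg'cont := hg_concave.continuousOn_of_hasDerivWithinAt hβ hg_deriv
  have hg'nonneg : ∀ s ∈ Icc 0 β, 0 ≤ g' s := fun s hs => by
    rw [← (hg_deriv s hs).derivWithin (uniqueDiffOn_Icc hβ s hs)]
    exact hg_mono.monotoneOn.derivWithin_nonneg
  have hg'mem : ∀ s ∈ Icc 0 β, g' s ∈ Icc (g' β) (g' 0) := fun s hs =>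
    ⟨hanti.antitoneOn hs (right_mem_Icc.2 hβ.le) hs.2,
      hanti.antitoneOn (left_mem_Icc.2 hβ.le) hs hs.1⟩
  have hhcont : ContinuousOn h (Icc (g' β) (g' 0)) := fun u hu =>
    (hh_deriv u hu).continuousWithinAt
  have hscalar : ∀ s ∈ Icc 0 β, ∀ u ∈ Icc (g' β) (g' 0), u ≠ g' s →
      g' s * s + h (g' s) < u * s + h u := fun s hs u hu hne =>
    mul_add_lt_of_deriv_eq_neg_inverse hanti hg_deriv hh_deriv hinv hs hu hne
  have hscalar_le : ∀ s ∈ Icc 0 β, ∀ u ∈ Icc (g' β) (g' 0),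
      g' s * s + h (g' s) ≤ u * s + h u := fun s hs u hu => by
    rcases eq_or_ne u (g' s) with rfl | hne
    · exact le_rfl
    · exact (hscalar s hs u hu hne).le
  have habsX : ∀ z ∈ X, ∀ i, |z i| ∈ Icc 0 β := fun z hz i => by
    subst hX
    exact ⟨abs_nonneg _, abs_le.2 (hz i)⟩
  have hXclosed : IsClosed X := by
    subst hX
    simp only [ofPred_forall]
    exact isClosed_iInter fun i => isClosed_Icc.preimage (by fun_prop)
  have hXcompact : IsCompact X := by
    have hpi : IsCompact (univ.pi fun _ : Fin n => Icc (-β) β) :=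
      isCompact_univ_pi fun _ => isCompact_Icc
    refine (hpi.image (PiLp.continuous_toLp 2 _)).of_isClosed_subset hXclosed fun z hz => ?_
    subst hX
    exact ⟨WithLp.ofLp z, fun i _ => hz i, rfl⟩
  let G : EuclideanSpace ℝ (Fin n) → EuclideanSpace ℝ (Fin n) :=
    fun z => WithLp.toLp 2 fun i => g' |z i|
  have hGcont : ContinuousOn G X := by
    refine (PiLp.continuous_toLp 2 _).comp_continuousOn (continuousOn_pi.2 fun i => ?_)
    exact hg'cont.comp (by fun_prop) fun z hz => habsX z hz i
  have hwG : ∀ t, w t = G (x t) := fun t => by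
    ext i
    exact hwupd t i
  have hGnonneg : ∀ z ∈ X, ∀ i, 0 ≤ G z i := fun z hz i => hg'nonneg _ (habsX z hz i)
  have hGY : ∀ z ∈ X, G z ∈ Y := fun z hz => by
    subst hY
    exact fun i => hg'mem _ (habsX z hz i)
  have hFQ : ∀ z v, F (z, v) = weightedLasso A y lam v z + lam * ∑ i, h (v i) := fun z v => by
    rw [hF, weightedLasso, Finset.sum_add_distrib]
    ring
  have hGmin : ∀ z ∈ X, ∀ v ∈ Y, F (z, G z) ≤ F (z, v) := fun z hz v hv => by
    subst hY
    rw [hF, hF]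
    exact add_le_add_right (mul_le_mul_of_nonneg_left
      (Finset.sum_le_sum fun i _ => hscalar_le _ (habsX z hz i) _ (hv i)) hlam.le) _
  have hGuniq : ∀ z ∈ X, ∀ v ∈ Y, F (z, v) = F (z, G z) → v = G z := fun z hz v hv heq => by
    subst hY
    by_contra hne
    obtain ⟨j, hj⟩ : ∃ j, v j ≠ G z j := by
      by_contra! hall
      exact hne (by ext i; exact hall i)
    refine heq.not_gt ?_
    rw [hF, hF]
    refine add_lt_add_right (mul_lt_mul_of_pos_left
      (Finset.sum_lt_sum
        (fun i _ => hscalar_le _ (habsX z hz i) _ (hv i))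
        ⟨j, Finset.mem_univ j, hscalar _ (habsX z hz j) _ (hv j) hj⟩) hlam) _
  have hxmin' : ∀ t, ∀ x' ∈ X, x' ≠ x (t + 1) →
      weightedLasso A y lam (w t) (x (t + 1)) < weightedLasso A y lam (w t) x' := hxmin
  have hxle : ∀ t, ∀ x' ∈ X,
      weightedLasso A y lam (w t) (x (t + 1)) ≤ weightedLasso A y lam (w t) x' :=
    fun t x' hx' => by
      rcases eq_or_ne x' (x (t + 1)) with rfl | hne
      · exact le_rfl
      · exact (hxmin' t x' hx' hne).le
  have hΦcont : ContinuousOn (fun z => F (z, G z)) X := by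
    simp only [hFQ]
    refine (continuous_weightedLasso.comp_continuousOn (hGcont.prodMk continuousOn_id)).add
      (continuousOn_const.mul (continuousOn_finsetSum _ fun i _ => ?_))
    refine hhcont.comp (hg'cont.comp (by fun_prop) fun z hz => habsX z hz i)
      fun z hz => hg'mem _ (habsX z hz i)
  have hΦanti : Antitone fun t => F (x t, G (x t)) := antitone_nat_of_succ_le fun t =>
    (hGmin _ (hxX (t + 1)) _ (hGY _ (hxX t))).trans (by
      rw [hFQ, hFQ, ← hwG]
      gcongr
      exact hxle t _ (hxX t))
  obtain ⟨L, hL⟩ : ∃ L, Tendsto (fun t => F (x t, G (x t))) atTop (𝓝 L) := by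
    refine ⟨_, tendsto_atTop_ciInf hΦanti
      ((hXcompact.image_of_continuousOn hΦcont).bddBelow.mono ?_)⟩
    rintro _ ⟨t, rfl⟩
    exact ⟨x t, hxX t, rfl⟩
  have hlimX : ∀ {U : Ultrafilter ℕ} {z : ℕ → EuclideanSpace ℝ (Fin n)} {a},
      (∀ t, z t ∈ X) → Tendsto z U (𝓝 a) → a ∈ X ∧ Tendsto z U (𝓝[X] a) :=
    fun hz ha => ⟨hXclosed.mem_of_tendsto ha (Eventually.of_forall hz),
      tendsto_nhdsWithin_iff.2 ⟨ha, Eventually.of_forall hz⟩⟩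
  have hlimmin : ∀ {U : Ultrafilter ℕ} {a b : EuclideanSpace ℝ (Fin n)},
      Tendsto x U (𝓝 a) → Tendsto (fun t => x (t + 1)) U (𝓝 b) →
      ∀ x' ∈ X, weightedLasso A y lam (G a) b ≤ weightedLasso A y lam (G a) x' := by
    intro U a b ha hb x' hx'
    obtain ⟨haX, haX'⟩ := hlimX hxX ha
    have hw : Tendsto w U (𝓝 (G a)) := by
      rw [funext hwG]
      exact (hGcont a haX).tendsto.comp haX'
    exact le_of_tendsto_of_tendsto'
      ((continuous_weightedLasso.tendsto (G a, b)).comp (hw.prodMk_nhds hb))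
      ((continuous_weightedLasso.tendsto (G a, x')).comp (hw.prodMk_nhds tendsto_const_nhds))
      fun t => hxle t x' hx'
  have hlimeq : ∀ {U : Ultrafilter ℕ} {a b : EuclideanSpace ℝ (Fin n)}, (U : Filter ℕ) ≤ atTop →
      Tendsto x U (𝓝 a) → Tendsto (fun t => x (t + 1)) U (𝓝 b) → a = b := by
    intro U a b hU ha hb
    obtain ⟨haX, haX'⟩ := hlimX hxX ha
    obtain ⟨hbX, hbX'⟩ := hlimX (fun t => hxX (t + 1)) hb
    have hmin := hlimmin ha hb
    have hΦa : F (a, G a) = L :=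
      tendsto_nhds_unique ((hΦcont a haX).tendsto.comp haX') (hL.mono_left hU)
    have hΦb : F (b, G b) = L :=
      tendsto_nhds_unique ((hΦcont b hbX).tendsto.comp hbX')
        ((hL.comp (tendsto_add_atTop_nat 1)).mono_left hU)
    have hle₁ := hGmin b hbX (G a) (hGY a haX)
    have hle₂ : F (b, G a) ≤ F (a, G a) := by
      rw [hFQ, hFQ]
      gcongr
      exact hmin a haX
    have hGab : G a = G b := hGuniq b hbX (G a) (hGY a haX) (by linarith)
    have habs : ∀ i, |a i| = |b i| := fun i =>
      hanti.injOn (habsX a haX i) (habsX b hbX i) (congrArg (fun v => v i) hGab)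
    have heq : weightedLasso A y lam (G a) a = weightedLasso A y lam (G a) b := by
      have hFeq : F (a, G a) = F (b, G a) := by linarith
      rw [hFQ, hFQ] at hFeq
      linarith
    refine eq_of_tendsto_weightedLasso_minimizers hX hlam.le
      (fun t i => hwG t ▸ hGnonneg _ (hxX t) i) (fun t => hxX (t + 1)) hb hxmin' habs ?_
    exact map_eq_of_weightedLasso_minimizers hX hlam.le (hGnonneg a haX) hbX habs heq hmin
  have hcluster : ∀ {z : ℕ → EuclideanSpace ℝ (Fin n)} (U : Ultrafilter ℕ), (∀ t, z t ∈ X) →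
      ∃ a, Tendsto z U (𝓝 a) := fun {z} U hz => by
    obtain ⟨a, -, ha⟩ := hXcompact.ultrafilter_le_nhds' (U.map z)
      (Filter.mem_map.2 (univ_mem' hz))
    exact ⟨a, ha⟩
  refine ⟨?_, fun p hp => ?_⟩
  · refine (tendsto_iff_ultrafilter _ _ _).2 fun U hU => ?_
    obtain ⟨a, ha⟩ := hcluster U hxX
    obtain ⟨b, hb⟩ := hcluster U fun t => hxX (t + 1)
    obtain rfl := hlimeq hU ha hb
    obtain ⟨haX, haX'⟩ := hlimX hxX ha
    have hb' := (hlimX (fun t => hxX (t + 1)) hb).2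
    have hGa := (hGcont a haX).tendsto
    simpa [hwG] using ((hb.prodMk_nhds (hGa.comp hb')).sub (ha.prodMk_nhds (hGa.comp haX'))).norm
  · obtain ⟨U, hU, hUp⟩ := mapClusterPt_iff_ultrafilter.1 hp
    have ha : Tendsto x U (𝓝 p.1) := (continuous_fst.tendsto p).comp hUp
    obtain ⟨haX, haX'⟩ := hlimX hxX ha
    have hp2 : p.2 = G p.1 := by
      refine tendsto_nhds_unique ((continuous_snd.tendsto p).comp hUp) ?_
      exact ((hGcont p.1 haX).tendsto.comp haX').congr fun t => (hwG t).symm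
    obtain ⟨b, hb⟩ := hcluster U fun t => hxX (t + 1)
    obtain rfl := hlimeq hU ha hb
    obtain ⟨a, v⟩ := p
    obtain rfl : v = G a := hp2
    refine ⟨fun x' hx' => ?_, hGmin a haX⟩
    rw [hFQ, hFQ]
    gcongr
    exact hlimmin ha hb x' hx'
end

section
/- Let A be a real m×n matrix, y ∈ ℝ^m, λ > 0, τ > 0 with τ‖A‖₂² < 1, let I ⊆ ℝ be an interval and h : I → ℝ, and set F(x,w) = (1/2)‖y − Ax‖₂² + λ Σ_{i=1}^n (w_i|x_i| + h(w_i)) for x ∈ ℝ^n, w ∈ I^n with w_i ≥ 0. Suppose x⁺ minimizes over ℝ^n the surrogate x ↦ (1/2)‖y − Ax‖₂² + (1/(2τ))‖x − b‖₂² − (1/2)‖A(x − b)‖₂² + λ Σ_i w_i|x_i|, and w⁺ ∈ I^n minimizes w ↦ F(x⁺, w) over I^n. Then F(x⁺, w⁺) ≤ F(b, w) − ((1 − τ‖A‖₂²)/(2τ))·‖x⁺ − b‖₂². -/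
/-- Sufficient decrease for the IST step of Algorithm 2: if `x⁺` minimizes the surrogate
at `b` (with weights `w`) and `w⁺` minimizes `F(x⁺, ·)` over `Iⁿ`, then
`F(x⁺,w⁺) ≤ F(b,w) − ((1 − τ‖A‖₂²)/(2τ))‖x⁺ − b‖₂²`. -/
theorem ist_sufficient_decrease (m n : ℕ)
    (A : EuclideanSpace ℝ (Fin n) →L[ℝ] EuclideanSpace ℝ (Fin m))
    (y : EuclideanSpace ℝ (Fin m)) (b : EuclideanSpace ℝ (Fin n))
    (lam τ : ℝ) (hlam : 0 < lam) (hτ : 0 < τ) (hA : τ * ‖A‖ ^ 2 < 1)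
    (I : Set ℝ) (hI : Convex ℝ I) (h : ℝ → ℝ)
    (F : EuclideanSpace ℝ (Fin n) × EuclideanSpace ℝ (Fin n) → ℝ)
    (hF : ∀ p, F p =
      (1 / 2) * ‖y - A p.1‖ ^ 2 + lam * ∑ i, (p.2 i * |p.1 i| + h (p.2 i)))
    (w : EuclideanSpace ℝ (Fin n)) (hwI : ∀ i, w i ∈ I) (hw0 : ∀ i, 0 ≤ w i)
    (xplus : EuclideanSpace ℝ (Fin n))
    (hxplus : ∀ x : EuclideanSpace ℝ (Fin n),
      (1 / 2) * ‖y - A xplus‖ ^ 2 + (1 / (2 * τ)) * ‖xplus - b‖ ^ 2 -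
          (1 / 2) * ‖A (xplus - b)‖ ^ 2 + lam * ∑ i, w i * |xplus i| ≤
        (1 / 2) * ‖y - A x‖ ^ 2 + (1 / (2 * τ)) * ‖x - b‖ ^ 2 -
          (1 / 2) * ‖A (x - b)‖ ^ 2 + lam * ∑ i, w i * |x i|)
    (wplus : EuclideanSpace ℝ (Fin n)) (hwplusI : ∀ i, wplus i ∈ I)
    (hwplus : ∀ w' : EuclideanSpace ℝ (Fin n), (∀ i, w' i ∈ I) →
      F (xplus, wplus) ≤ F (xplus, w')) :
    F (xplus, wplus) ≤ F (b, w) - ((1 - τ * ‖A‖ ^ 2) / (2 * τ)) * ‖xplus - b‖ ^ 2 := by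
  have hx := hxplus b
  have hw := hwplus w hwI
  rw [hF (xplus, w)] at hw
  rw [hF (b, w)]
  simp only [sub_self, map_zero, norm_zero, Finset.sum_add_distrib, mul_add] at hx hw ⊢
  have hop : ‖A (xplus - b)‖ ^ 2 ≤ ‖A‖ ^ 2 * ‖xplus - b‖ ^ 2 := by
    rw [← mul_pow]
    gcongr
    exact A.le_opNorm _
  have hcoef : (1 - τ * ‖A‖ ^ 2) / (2 * τ) * ‖xplus - b‖ ^ 2 =
      1 / (2 * τ) * ‖xplus - b‖ ^ 2 - 1 / 2 * (‖A‖ ^ 2 * ‖xplus - b‖ ^ 2) := by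
    field_simp
  rw [hcoef]
  linarith
end
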